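/- arXiv:1704.01393 — 3 statements merged into one kernel-verified Lean document; each statement's English description precedes it below -/
import Mathlib

section
/- In the quantum Schrödinger algebra, for all r, s ∈ ℕ, X^r Y^s = q^{rs} Y^s X^r + Σ_{i=1}^{min(r,s)} (-1)^i q^{rs+i} (∏_{j=0}^{i-1} (1-q^{-r+j})(1-q^{-s+j}) / ((q-1)(q^{j+1}-1))) C^i Y^{s-i} X^{r-i}. -/
/-- A representation of the quantum Schrödinger algebra `S_q`: elements of a
`ℂ`-algebra `A` satisfying the defining relations of `S_q`. -/
structure SqRep (A : Type*) [Ring A] [Algebra ℂ A] (q : ℂ) where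
  C : A
  E : A
  F : A
  K : A
  K' : A
  X : A
  Y : A
  hKK' : K * K' = 1
  hK'K : K' * K = 1
  hKE : K * E = (q ^ 2) • (E * K)
  hKF : K * F = ((q ^ 2)⁻¹) • (F * K)
  hEF : E * F - F * E = (q - q⁻¹)⁻¹ • (K - K')
  hKX : K * X = q • (X * K)
  hKY : K * Y = q⁻¹ • (Y * K)
  hYX : q • (Y * X) - X * Y = C
  hEX : E * X = q • (X * E)
  hEY : E * Y = X + q⁻¹ • (Y * E)
  hCE : C * E = E * C
  hCF : C * F = F * C
  hCK : C * K = K * C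
  hCK' : C * K' = K' * C
  hCX : C * X = X * C
  hCY : C * Y = Y * C
  hFX : F * X = Y * K' + X * F
  hFY : F * Y = Y * F

/-- The coefficient of `C ^ i * Y ^ (s - i) * X ^ (r - i)` in `X ^ r * Y ^ s`. -/
noncomputable def reorderCoeff (q : ℂ) (r s i : ℕ) : ℂ :=
  (-1 : ℂ) ^ i * q ^ (r * s + i) *
    ∏ j ∈ Finset.range i,
      ((1 - q ^ ((j : ℤ) - (r : ℤ))) * (1 - q ^ ((j : ℤ) - (s : ℤ))) /
        ((q - 1) * (q ^ (j + 1) - 1)))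

lemma reorderCoeff_zero (q : ℂ) (r s : ℕ) : reorderCoeff q r s 0 = q ^ (r * s) := by
  simp [reorderCoeff]

lemma reorderCoeff_eq_zero_of_left_lt (q : ℂ) {r s i : ℕ} (h : r < i) :
    reorderCoeff q r s i = 0 := by
  rw [reorderCoeff, Finset.prod_eq_zero (Finset.mem_range.2 h) (by simp), mul_zero]

lemma reorderCoeff_eq_zero_of_right_lt (q : ℂ) {r s i : ℕ} (h : s < i) :
    reorderCoeff q r s i = 0 := by
  rw [reorderCoeff, Finset.prod_eq_zero (Finset.mem_range.2 h) (by simp), mul_zero]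

lemma reorderCoeff_succ_left_succ {q : ℂ} (hq : q ≠ 0) (hroot : ∀ n : ℕ, 0 < n → q ^ n ≠ 1)
    (r s i : ℕ) :
    reorderCoeff q (r + 1) s (i + 1) =
      q ^ ((s : ℤ) - (i + 1 : ℕ)) * reorderCoeff q r s (i + 1) -
        (q ^ ((s : ℤ) - i) - 1) / (q - 1) * reorderCoeff q r s i := by
  have hq1 : q - 1 ≠ 0 := sub_ne_zero.2 (by simpa using hroot 1 one_pos)
  have hqi : q * q ^ i - 1 ≠ 0 := by
    have := sub_ne_zero.2 (hroot (i + 1) i.succ_pos)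
    rwa [pow_succ'] at this
  have hD : ∏ j ∈ Finset.range i, ((q - 1) * (q ^ (j + 1) - 1)) ≠ 0 :=
    Finset.prod_ne_zero_iff.2 fun j _ =>
      mul_ne_zero hq1 (sub_ne_zero.2 (hroot (j + 1) j.succ_pos))
  have hshift : ∏ j ∈ Finset.range (i + 1), (1 - q ^ ((j : ℤ) - ((r + 1 : ℕ) : ℤ))) =
      (∏ j ∈ Finset.range i, (1 - q ^ ((j : ℤ) - (r : ℤ)))) * (1 - (q ^ (r + 1))⁻¹) := by
    rw [Finset.prod_range_succ']
    refine congrArg₂ _ (Finset.prod_congr rfl fun j _ => ?_) ?_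
    · rw [Nat.cast_succ, Nat.cast_succ, add_sub_add_right_eq_sub]
    · rw [Nat.cast_zero, zero_sub, zpow_neg, zpow_natCast]
  simp only [reorderCoeff, Finset.prod_div_distrib, Finset.prod_mul_distrib (s := Finset.range _)
    (f := fun j : ℕ => 1 - q ^ ((j : ℤ) - _)), hshift]
  rw [Finset.prod_range_succ (fun j : ℕ => (q - 1) * (q ^ (j + 1) - 1)),
    Finset.prod_range_succ (fun j : ℕ => 1 - q ^ ((j : ℤ) - (s : ℤ))),
    Finset.prod_range_succ (fun j : ℕ => 1 - q ^ ((j : ℤ) - (r : ℤ)))]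
  generalize ∏ j ∈ Finset.range i, (1 - q ^ ((j : ℤ) - (r : ℤ))) = a
  generalize ∏ j ∈ Finset.range i, (1 - q ^ ((j : ℤ) - (s : ℤ))) = b
  generalize ∏ j ∈ Finset.range i, ((q - 1) * (q ^ (j + 1) - 1)) = d at hD ⊢
  simp only [zpow_sub₀ hq, zpow_natCast, pow_succ', pow_add, add_mul, one_mul]
  generalize q ^ (r * s) = t
  have hi : q ^ i ≠ 0 := pow_ne_zero _ hq
  have hr : q ^ r ≠ 0 := pow_ne_zero _ hq
  have hs : q ^ s ≠ 0 := pow_ne_zero _ hq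
  generalize q ^ i = u at *
  generalize q ^ r = v at *
  generalize q ^ s = w at *
  field_simp
  ring

namespace SqRep

variable {A : Type*} [Ring A] [Algebra ℂ A] {q : ℂ} (R : SqRep A q)

lemma X_mul_Y : R.X * R.Y = q • (R.Y * R.X) - R.C := by
  rw [← R.hYX]
  abel

lemma X_mul_Y_pow (hq1 : q - 1 ≠ 0) (m : ℕ) :
    R.X * R.Y ^ m =
      q ^ m • (R.Y ^ m * R.X) - ((q ^ m - 1) / (q - 1)) • (R.C * R.Y ^ (m - 1)) := by
  induction m with
  | zero => simp
  | succ m ih =>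
    have hCY : ((q ^ m - 1) / (q - 1)) • (R.C * R.Y ^ (m - 1) * R.Y) =
        ((q ^ m - 1) / (q - 1)) • (R.C * R.Y ^ m) := by
      cases m with
      | zero => simp
      | succ m => rw [mul_assoc, Nat.add_sub_cancel, ← pow_succ]
    have hC : R.Y ^ m * R.C = R.C * R.Y ^ m := (Commute.pow_right R.hCY m).symm
    have hcoeff : (q ^ (m + 1) - 1) / (q - 1) = q ^ m + (q ^ m - 1) / (q - 1) := by
      field_simp
      ring
    rw [pow_succ, ← mul_assoc, ih, sub_mul, smul_mul_assoc, smul_mul_assoc, hCY, mul_assoc,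
      X_mul_Y, mul_sub, hC, mul_smul_comm, ← mul_assoc, smul_sub, smul_smul, ← pow_succ,
      ← pow_succ, hcoeff, add_smul, Nat.add_sub_cancel]
    abel

lemma X_mul_ordered_monomial (hq1 : q - 1 ≠ 0) (r s i : ℕ) (hr : i ≤ r) (hs : i ≤ s) :
    R.X * (R.C ^ i * (R.Y ^ (s - i) * R.X ^ (r - i))) =
      q ^ ((s : ℤ) - i) • (R.C ^ i * (R.Y ^ (s - i) * R.X ^ (r + 1 - i))) -
        ((q ^ ((s : ℤ) - i) - 1) / (q - 1)) •
          (R.C ^ (i + 1) * (R.Y ^ (s - (i + 1)) * R.X ^ (r + 1 - (i + 1)))) := by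
  have hXC : R.X * R.C ^ i = R.C ^ i * R.X := (Commute.pow_left R.hCX i).symm
  have hz : q ^ ((s : ℤ) - i) = q ^ (s - i) := by
    rw [← Nat.cast_sub hs, zpow_natCast]
  rw [hz, ← mul_assoc, hXC, mul_assoc, ← mul_assoc R.X, X_mul_Y_pow R hq1, sub_mul, mul_sub,
    smul_mul_assoc, smul_mul_assoc, mul_smul_comm, mul_smul_comm, Nat.sub_add_comm hr,
    pow_succ' R.X, pow_succ R.C, Nat.add_sub_add_right, Nat.sub_sub]
  simp only [mul_assoc]

lemma X_pow_mul_Y_pow (hq : q ≠ 0) (hroot : ∀ n : ℕ, 0 < n → q ^ n ≠ 1) (r s : ℕ) :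
    R.X ^ r * R.Y ^ s =
      ∑ i ∈ Finset.range (r + 1),
        reorderCoeff q r s i • (R.C ^ i * (R.Y ^ (s - i) * R.X ^ (r - i))) := by
  have hq1 : q - 1 ≠ 0 := sub_ne_zero.2 (by simpa using hroot 1 one_pos)
  induction r with
  | zero => simp [reorderCoeff_zero]
  | succ r ih =>
    have hterm : ∀ i ∈ Finset.range (r + 1),
        R.X * (reorderCoeff q r s i • (R.C ^ i * (R.Y ^ (s - i) * R.X ^ (r - i)))) =
          (q ^ ((s : ℤ) - i) * reorderCoeff q r s i) •
              (R.C ^ i * (R.Y ^ (s - i) * R.X ^ (r + 1 - i))) -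
            ((q ^ ((s : ℤ) - i) - 1) / (q - 1) * reorderCoeff q r s i) •
              (R.C ^ (i + 1) * (R.Y ^ (s - (i + 1)) * R.X ^ (r + 1 - (i + 1)))) := by
      intro i hi
      rcases le_or_gt i s with hs | hs
      · rw [mul_smul_comm, X_mul_ordered_monomial R hq1 r s i
          (Nat.lt_succ_iff.1 (Finset.mem_range.1 hi)) hs, smul_sub, smul_smul, smul_smul,
          mul_comm (reorderCoeff q r s i), mul_comm (reorderCoeff q r s i)]
      · simp [reorderCoeff_eq_zero_of_right_lt q hs]
    have hextend : ∑ i ∈ Finset.range (r + 1), (q ^ ((s : ℤ) - i) * reorderCoeff q r s i) •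
          (R.C ^ i * (R.Y ^ (s - i) * R.X ^ (r + 1 - i))) =
        ∑ i ∈ Finset.range (r + 1 + 1), (q ^ ((s : ℤ) - i) * reorderCoeff q r s i) •
          (R.C ^ i * (R.Y ^ (s - i) * R.X ^ (r + 1 - i))) := by
      rw [Finset.sum_range_succ _ (r + 1), reorderCoeff_eq_zero_of_left_lt q r.lt_succ_self,
        mul_zero, zero_smul, add_zero]
    have hzero : q ^ ((s : ℤ) - (0 : ℕ)) * reorderCoeff q r s 0 =
        reorderCoeff q (r + 1) s 0 := by
      rw [reorderCoeff_zero, reorderCoeff_zero, Nat.cast_zero, sub_zero, zpow_natCast]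
      ring
    rw [pow_succ', mul_assoc, ih, Finset.mul_sum, Finset.sum_congr rfl hterm,
      Finset.sum_sub_distrib, hextend, Finset.sum_range_succ', Finset.sum_range_succ' _ (r + 1),
      hzero, add_sub_right_comm, ← Finset.sum_sub_distrib]
    congr 1
    refine Finset.sum_congr rfl fun i _ => ?_
    rw [← sub_smul, reorderCoeff_succ_left_succ hq hroot]

end SqRep

theorem stmt9 {A : Type*} [Ring A] [Algebra ℂ A] {q : ℂ}
    (hq : q ≠ 0) (hroot : ∀ n : ℕ, 0 < n → q ^ n ≠ 1) (R : SqRep A q) (r s : ℕ) :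
    R.X ^ r * R.Y ^ s
      = (q ^ (r * s)) • (R.Y ^ s * R.X ^ r)
        + ∑ i ∈ Finset.Icc 1 (min r s),
            ((-1 : ℂ) ^ i * q ^ (r * s + i) *
              ∏ j ∈ Finset.range i,
                ((1 - q ^ ((j : ℤ) - (r : ℤ))) * (1 - q ^ ((j : ℤ) - (s : ℤ))) /
                  ((q - 1) * (q ^ (j + 1) - 1)))) •
            (R.C ^ i * (R.Y ^ (s - i) * R.X ^ (r - i))) := by
  have hsub : Finset.Icc 1 (min r s) ⊆ Finset.Icc 1 r :=
    Finset.Icc_subset_Icc_right (min_le_left r s)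
  have hsum := Finset.sum_subset hsub
    (f := fun i => reorderCoeff q r s i • (R.C ^ i * (R.Y ^ (s - i) * R.X ^ (r - i)))) (by
      intro i hi hi'
      rw [Finset.mem_Icc] at hi hi'
      rw [reorderCoeff_eq_zero_of_right_lt q (by omega), zero_smul])
  refine (R.X_pow_mul_Y_pow hq hroot r s).trans ?_
  rw [Finset.range_eq_Ico, Finset.sum_eq_sum_Ico_succ_bot r.succ_pos, reorderCoeff_zero]
  simp only [pow_zero, one_mul, Nat.sub_zero]
  exact congrArg _ hsum.symm
end

section
/- For each b ∈ ℂ*, the assignment Θ_b^{(Y)}(Y^{±1})=Y^{±1}, Θ_b^{(Y)}(F)=F, Θ_b^{(Y)}(C)=C, Θ_b^{(Y)}(X)=bX-((b-1)/(q-1))CY⁻¹, Θ_b^{(Y)}(K^i)=b^{-i}K^i, Θ_b^{(Y)}(E)=b⁻¹E+((b-b⁻¹)/(q-q⁻¹))Y⁻¹X-((b+qb⁻¹-q-1)/((q-q⁻¹)(q-1)))CY⁻² extends uniquely to an algebra automorphism of the localization S_q^{(Y)} of S_q at the powers of Y. -/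
/-- Generators of the localization `S_q^{(Y)}` of the quantum Schrödinger algebra at
the powers of `Y`: the generators of `S_q` together with `y'` = `Y⁻¹`. -/
inductive SqYGen | c | e | f | k | k' | x | y | y'

open FreeAlgebra in
/-- The defining relations of `S_q^{(Y)}`: the relations of `S_q` together with the
relations making `y'` a two-sided inverse of `Y` (since the powers of `Y` form a left and
right Ore set in `S_q`, the Ore localization coincides with this universal
`Y`-inverting algebra). -/
inductive SqYRel (q : ℂ) : FreeAlgebra ℂ SqYGen → FreeAlgebra ℂ SqYGen → Prop
  | kk' : SqYRel q (ι ℂ SqYGen.k * ι ℂ SqYGen.k') 1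
  | k'k : SqYRel q (ι ℂ SqYGen.k' * ι ℂ SqYGen.k) 1
  | yy' : SqYRel q (ι ℂ SqYGen.y * ι ℂ SqYGen.y') 1
  | y'y : SqYRel q (ι ℂ SqYGen.y' * ι ℂ SqYGen.y) 1
  | ke : SqYRel q (ι ℂ SqYGen.k * ι ℂ SqYGen.e) ((q ^ 2) • (ι ℂ SqYGen.e * ι ℂ SqYGen.k))
  | kf : SqYRel q (ι ℂ SqYGen.k * ι ℂ SqYGen.f) (((q ^ 2)⁻¹) • (ι ℂ SqYGen.f * ι ℂ SqYGen.k))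
  | ef : SqYRel q (ι ℂ SqYGen.e * ι ℂ SqYGen.f - ι ℂ SqYGen.f * ι ℂ SqYGen.e)
      ((q - q⁻¹)⁻¹ • (ι ℂ SqYGen.k - ι ℂ SqYGen.k'))
  | kx : SqYRel q (ι ℂ SqYGen.k * ι ℂ SqYGen.x) (q • (ι ℂ SqYGen.x * ι ℂ SqYGen.k))
  | ky : SqYRel q (ι ℂ SqYGen.k * ι ℂ SqYGen.y) (q⁻¹ • (ι ℂ SqYGen.y * ι ℂ SqYGen.k))
  | yx : SqYRel q (q • (ι ℂ SqYGen.y * ι ℂ SqYGen.x) - ι ℂ SqYGen.x * ι ℂ SqYGen.y)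
      (ι ℂ SqYGen.c)
  | ex : SqYRel q (ι ℂ SqYGen.e * ι ℂ SqYGen.x) (q • (ι ℂ SqYGen.x * ι ℂ SqYGen.e))
  | ey : SqYRel q (ι ℂ SqYGen.e * ι ℂ SqYGen.y)
      (ι ℂ SqYGen.x + q⁻¹ • (ι ℂ SqYGen.y * ι ℂ SqYGen.e))
  | central (g : SqYGen) : SqYRel q (ι ℂ SqYGen.c * ι ℂ g) (ι ℂ g * ι ℂ SqYGen.c)
  | fx : SqYRel q (ι ℂ SqYGen.f * ι ℂ SqYGen.x)
      (ι ℂ SqYGen.y * ι ℂ SqYGen.k' + ι ℂ SqYGen.x * ι ℂ SqYGen.f)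
  | fy : SqYRel q (ι ℂ SqYGen.f * ι ℂ SqYGen.y) (ι ℂ SqYGen.y * ι ℂ SqYGen.f)

/-- The localization `S_q^{(Y)}`. -/
abbrev SqY (q : ℂ) := RingQuot (SqYRel q)

/-- The canonical generators of `S_q^{(Y)}`. -/
noncomputable def sqYGen (q : ℂ) (g : SqYGen) : SqY q :=
  RingQuot.mkAlgHom ℂ (SqYRel q) (FreeAlgebra.ι ℂ g)

open SqYGen in
/-- A family of elements of a `ℂ`-algebra satisfying the defining relations of `S_q^{(Y)}`. -/
structure SqYFamily {A : Type*} [Ring A] [Algebra ℂ A] (q : ℂ) (g : SqYGen → A) : Prop where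
  kk' : g k * g k' = 1
  k'k : g k' * g k = 1
  yy' : g y * g y' = 1
  y'y : g y' * g y = 1
  ke : g k * g e = (q ^ 2) • (g e * g k)
  kf : g k * g f = ((q ^ 2)⁻¹) • (g f * g k)
  ef : g e * g f - g f * g e = (q - q⁻¹)⁻¹ • (g k - g k')
  kx : g k * g x = q • (g x * g k)
  ky : g k * g y = q⁻¹ • (g y * g k)
  yx : q • (g y * g x) - g x * g y = g c
  ex : g e * g x = q • (g x * g e)
  ey : g e * g y = g x + q⁻¹ • (g y * g e)
  central (i : SqYGen) : g c * g i = g i * g c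
  fx : g f * g x = g y * g k' + g x * g f
  fy : g f * g y = g y * g f

open SqYGen in
/-- The images of the generators under `Θ_b^{(Y)}`, as a function of the generators. -/
noncomputable def sqYTheta {A : Type*} [Ring A] [Algebra ℂ A] (q b : ℂ) (g : SqYGen → A) :
    SqYGen → A
  | c => g c
  | e => b⁻¹ • g e + ((b - b⁻¹) / (q - q⁻¹)) • (g y' * g x)
      - ((b + q * b⁻¹ - q - 1) / ((q - q⁻¹) * (q - 1))) • (g c * g y' ^ 2)
  | f => g f
  | k => b⁻¹ • g k
  | k' => b • g k'
  | x => b • g x - ((b - 1) / (q - 1)) • (g c * g y')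
  | y => g y
  | y' => g y'

open SqYGen

namespace SqYFamily

theorem mul_eq_assoc {A : Type*} [Ring A] {a b d : A} (h : a * b = d) (z : A) :
    a * (b * z) = d * z := by
  rw [← mul_assoc, h]

variable {A : Type*} [Ring A] [Algebra ℂ A] {q : ℂ} {g : SqYGen → A}

theorem x_mul_y' (h : SqYFamily q g) (hq : q ≠ 0) :
    g x * g y' = q⁻¹ • (g y' * g x + g c * (g y' * g y')) := by
  have h1 : g y' * (q • (g y * g x) - g x * g y) * g y' = g y' * g c * g y' := by rw [h.yx]
  rw [← h.central y', mul_sub, sub_mul, mul_smul_comm, ← mul_assoc, h.y'y, one_mul,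
    ← mul_assoc, mul_assoc _ (g y), h.yy', mul_one, smul_mul_assoc, mul_assoc,
    sub_eq_iff_eq_add] at h1
  rw [eq_inv_smul_iff₀ hq, h1, add_comm]

theorem e_mul_y' (h : SqYFamily q g) (hq : q ≠ 0) :
    g e * g y' = q • (g y' * g e) - g y' * (g y' * g x) - g c * (g y' * (g y' * g y')) := by
  have h1 : g y' * (g e * g y) * g y' = g y' * (g x + q⁻¹ • (g y * g e)) * g y' := by rw [h.ey]
  rw [← mul_assoc, mul_assoc _ (g y), h.yy', mul_one, mul_add, add_mul, mul_smul_comm,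
    ← mul_assoc, h.y'y, one_mul, mul_assoc, h.x_mul_y' hq, smul_mul_assoc, mul_smul_comm,
    ← smul_add, eq_inv_smul_iff₀ hq, mul_add, mul_eq_assoc (h.central y').symm, mul_assoc] at h1
  rw [h1]
  abel

theorem k_mul_y' (h : SqYFamily q g) (hq : q ≠ 0) : g k * g y' = q • (g y' * g k) := by
  have h1 : g y' * (g k * g y) * g y' = g y' * (q⁻¹ • (g y * g k)) * g y' := by rw [h.ky]
  rw [← mul_assoc, mul_assoc _ (g y), h.yy', mul_one, mul_smul_comm, ← mul_assoc, h.y'y,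
    one_mul, smul_mul_assoc, eq_inv_smul_iff₀ hq] at h1
  exact h1.symm

theorem f_mul_y' (h : SqYFamily q g) : g f * g y' = g y' * g f := by
  have h1 : g y' * (g f * g y) * g y' = g y' * (g y * g f) * g y' := by rw [h.fy]
  rw [← mul_assoc, mul_assoc _ (g y), h.yy', mul_one, ← mul_assoc, h.y'y, one_mul] at h1
  exact h1.symm

theorem theta (h : SqYFamily q g) (hq : q ≠ 0) (h1 : q - 1 ≠ 0) (h2 : q ^ 2 - 1 ≠ 0)
    {b : ℂ} (hb : b ≠ 0) : SqYFamily q (sqYTheta q b g) := by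
  have xy : g x * g y = q • (g y * g x) - g c := by rw [← h.yx]; abel
  have ef : g e * g f = g f * g e + (q - q⁻¹)⁻¹ • (g k - g k') := by rw [← h.ef]; abel
  have xf : g x * g f = g f * g x - g y * g k' := by rw [h.fx]; abel
  have y'f := h.f_mul_y'.symm
  have xy' := h.x_mul_y' hq
  have ey' := h.e_mul_y' hq
  have ky' := h.k_mul_y' hq
  have xc := (h.central x).symm
  have ec := (h.central e).symm
  have y'c := (h.central y').symm
  have yc := (h.central y).symm
  have kc := (h.central k).symm
  have k'c := (h.central k').symm
  have fc := (h.central f).symm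
  constructor
  case central =>
    intro i
    cases i <;> simp only [sqYTheta, pow_two, mul_add, add_mul, mul_sub, sub_mul, mul_smul_comm,
      smul_mul_assoc, mul_assoc, xc, ec, y'c, yc, kc, k'c, fc, mul_eq_assoc y'c]
  case kk' => simp [sqYTheta, h.kk', smul_smul, hb]
  case k'k => simp [sqYTheta, h.k'k, smul_smul, hb]
  case yy' => exact h.yy'
  case y'y => exact h.y'y
  case fy => exact h.fy
  all_goals
    simp only [sqYTheta, pow_two, mul_add, add_mul, mul_sub, sub_mul, mul_smul_comm,
      smul_mul_assoc, mul_assoc, one_mul, mul_one, smul_add, smul_sub, smul_smul,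
      y'c, mul_eq_assoc y'c, mul_eq_assoc xc, mul_eq_assoc ec, mul_eq_assoc yc, mul_eq_assoc kc,
      mul_eq_assoc fc, xy, ef, xf, y'f, xy', ey', ky', h.ex, h.ey, h.ke, h.kf, h.kx, h.ky,
      h.yy', h.y'y, mul_eq_assoc xy', mul_eq_assoc ky', mul_eq_assoc h.yy',
      mul_eq_assoc h.y'y, mul_eq_assoc y'f]
    match_scalars <;> field_simp <;> ring

end SqYFamily

theorem sqYTheta_inv {A : Type*} [Ring A] [Algebra ℂ A] {q b : ℂ}
    (h1 : q - 1 ≠ 0) (h2 : q ^ 2 - 1 ≠ 0) (hb : b ≠ 0) {g : SqYGen → A} (h : SqYFamily q g) :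
    sqYTheta q b⁻¹ (sqYTheta q b g) = g := by
  have y'c := (h.central y').symm
  funext i
  cases i
  case e =>
    simp only [sqYTheta, pow_two, mul_sub, mul_smul_comm, SqYFamily.mul_eq_assoc y'c, mul_assoc]
    match_scalars <;> field_simp <;> ring
  all_goals
    simp only [sqYTheta]
    try
      match_scalars <;> field_simp <;> ring

theorem sqYFamily_sqYGen (q : ℂ) : SqYFamily q (sqYGen q) := by
  constructor
  case central =>
    intro i
    simpa [sqYGen] using RingQuot.mkAlgHom_rel ℂ (SqYRel.central (q := q) i)
  · simpa [sqYGen] using RingQuot.mkAlgHom_rel ℂ (SqYRel.kk' (q := q))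
  · simpa [sqYGen] using RingQuot.mkAlgHom_rel ℂ (SqYRel.k'k (q := q))
  · simpa [sqYGen] using RingQuot.mkAlgHom_rel ℂ (SqYRel.yy' (q := q))
  · simpa [sqYGen] using RingQuot.mkAlgHom_rel ℂ (SqYRel.y'y (q := q))
  · simpa [sqYGen] using RingQuot.mkAlgHom_rel ℂ (SqYRel.ke (q := q))
  · simpa [sqYGen] using RingQuot.mkAlgHom_rel ℂ (SqYRel.kf (q := q))
  · simpa [sqYGen] using RingQuot.mkAlgHom_rel ℂ (SqYRel.ef (q := q))
  · simpa [sqYGen] using RingQuot.mkAlgHom_rel ℂ (SqYRel.kx (q := q))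
  · simpa [sqYGen] using RingQuot.mkAlgHom_rel ℂ (SqYRel.ky (q := q))
  · simpa [sqYGen] using RingQuot.mkAlgHom_rel ℂ (SqYRel.yx (q := q))
  · simpa [sqYGen] using RingQuot.mkAlgHom_rel ℂ (SqYRel.ex (q := q))
  · simpa [sqYGen] using RingQuot.mkAlgHom_rel ℂ (SqYRel.ey (q := q))
  · simpa [sqYGen] using RingQuot.mkAlgHom_rel ℂ (SqYRel.fx (q := q))
  · simpa [sqYGen] using RingQuot.mkAlgHom_rel ℂ (SqYRel.fy (q := q))

/-- The universal property of `S_q^{(Y)}`. -/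
theorem exists_algHom_sqYGen {A : Type*} [Ring A] [Algebra ℂ A] {q : ℂ} {g : SqYGen → A}
    (h : SqYFamily q g) : ∃ φ : SqY q →ₐ[ℂ] A, ∀ i, φ (sqYGen q i) = g i := by
  refine ⟨RingQuot.liftAlgHom ℂ ⟨FreeAlgebra.lift ℂ g, fun u v r => ?_⟩, fun i => ?_⟩
  · cases r with
    | kk' => simpa using h.kk'
    | k'k => simpa using h.k'k
    | yy' => simpa using h.yy'
    | y'y => simpa using h.y'y
    | ke => simpa using h.ke
    | kf => simpa using h.kf
    | ef => simpa using h.ef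
    | kx => simpa using h.kx
    | ky => simpa using h.ky
    | yx => simpa using h.yx
    | ex => simpa using h.ex
    | ey => simpa using h.ey
    | central i => simpa using h.central i
    | fx => simpa using h.fx
    | fy => simpa using h.fy
  · simp [sqYGen]

theorem sqY_algHom_ext {A : Type*} [Ring A] [Algebra ℂ A] {q : ℂ} {φ ψ : SqY q →ₐ[ℂ] A}
    (h : ∀ i, φ (sqYGen q i) = ψ (sqYGen q i)) : φ = ψ := by
  apply RingQuot.ringQuot_ext'
  apply FreeAlgebra.hom_ext
  funext i
  exact h i

theorem map_sqYTheta {A B : Type*} [Ring A] [Algebra ℂ A] [Ring B] [Algebra ℂ B] (q b : ℂ)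
    (φ : A →ₐ[ℂ] B) (g : SqYGen → A) (i : SqYGen) :
    φ (sqYTheta q b g i) = sqYTheta q b (fun j => φ (g j)) i := by
  cases i <;> simp [sqYTheta]

/-- For each `b ∈ ℂ*`, the assignment `Θ_b^{(Y)}` on the generators extends uniquely to
an algebra automorphism of the localization `S_q^{(Y)}`. -/
theorem stmt17 (q : ℂ) (hq : q ≠ 0) (hroot : ∀ n : ℕ, 0 < n → q ^ n ≠ 1)
    (b : ℂ) (hb : b ≠ 0) :
    ∃! θ : SqY q ≃ₐ[ℂ] SqY q,
      θ (sqYGen q SqYGen.y) = sqYGen q SqYGen.y ∧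
      θ (sqYGen q SqYGen.y') = sqYGen q SqYGen.y' ∧
      θ (sqYGen q SqYGen.f) = sqYGen q SqYGen.f ∧
      θ (sqYGen q SqYGen.c) = sqYGen q SqYGen.c ∧
      θ (sqYGen q SqYGen.x)
        = b • sqYGen q SqYGen.x
          - ((b - 1) / (q - 1)) • (sqYGen q SqYGen.c * sqYGen q SqYGen.y') ∧
      θ (sqYGen q SqYGen.k) = b⁻¹ • sqYGen q SqYGen.k ∧
      θ (sqYGen q SqYGen.k') = b • sqYGen q SqYGen.k' ∧
      θ (sqYGen q SqYGen.e)
        = b⁻¹ • sqYGen q SqYGen.e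
          + ((b - b⁻¹) / (q - q⁻¹)) • (sqYGen q SqYGen.y' * sqYGen q SqYGen.x)
          - ((b + q * b⁻¹ - q - 1) / ((q - q⁻¹) * (q - 1))) •
              (sqYGen q SqYGen.c * sqYGen q SqYGen.y' ^ 2) := by
  have h1 : q - 1 ≠ 0 := sub_ne_zero.mpr (by simpa using hroot 1 one_pos)
  have h2 : q ^ 2 - 1 ≠ 0 := sub_ne_zero.mpr (hroot 2 two_pos)
  have hg := sqYFamily_sqYGen q
  obtain ⟨φ, hφ⟩ := exists_algHom_sqYGen (hg.theta hq h1 h2 hb)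
  obtain ⟨ψ, hψ⟩ := exists_algHom_sqYGen (hg.theta hq h1 h2 (inv_ne_zero hb))
  have hφψ : φ.comp ψ = AlgHom.id ℂ (SqY q) := sqY_algHom_ext fun i => by
    rw [AlgHom.comp_apply, hψ, map_sqYTheta, funext hφ, sqYTheta_inv h1 h2 hb hg,
      AlgHom.id_apply]
  have hψφ : ψ.comp φ = AlgHom.id ℂ (SqY q) := sqY_algHom_ext fun i => by
    have := sqYTheta_inv h1 h2 (inv_ne_zero hb) hg
    rw [inv_inv] at this
    rw [AlgHom.comp_apply, hφ, map_sqYTheta, funext hψ, this, AlgHom.id_apply]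
  refine ⟨AlgEquiv.ofAlgHom φ ψ hφψ hψφ,
    ⟨hφ y, hφ y', hφ f, hφ c, hφ x, hφ k, hφ k', hφ e⟩, ?_⟩
  rintro θ ⟨hy, hy', hf, hc, hx, hk, hk', he⟩
  have hθ : (θ : SqY q →ₐ[ℂ] SqY q) = φ := sqY_algHom_ext fun i => by
    rw [hφ]
    cases i
    exacts [hc, he, hf, hk, hk', hx, hy, hy']
  exact AlgEquiv.ext fun z => DFunLike.congr_fun hθ z
end

section
/- For u ∈ {F, Y} and x, y ∈ ℂ*, the twisting automorphisms satisfy Θ_x^{(u)} ∘ Θ_y^{(u)} = Θ_{xy}^{(u)} on the localization S_q^{(u)}. -/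
/-- Generators of the localization `S_q^{(w)}` of the quantum Schrödinger algebra at the
powers of a generator `w ∈ {F, Y}`: the generators of `S_q` together with `u = w⁻¹`. -/
inductive SqLGen | c | e | f | k | k' | x | y | u

open FreeAlgebra in
/-- The defining relations of `S_q^{(w)}`: the relations of `S_q` together with the
relations making `u` a two-sided inverse of the chosen generator `w` (for `w ∈ {F, Y}`
the powers of `w` form a left and right Ore set, and the Ore localization coincides with
this universal `w`-inverting algebra). -/
inductive SqLRel (q : ℂ) (w : SqLGen) : FreeAlgebra ℂ SqLGen → FreeAlgebra ℂ SqLGen → Prop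
  | kk' : SqLRel q w (ι ℂ SqLGen.k * ι ℂ SqLGen.k') 1
  | k'k : SqLRel q w (ι ℂ SqLGen.k' * ι ℂ SqLGen.k) 1
  | wu : SqLRel q w (ι ℂ w * ι ℂ SqLGen.u) 1
  | uw : SqLRel q w (ι ℂ SqLGen.u * ι ℂ w) 1
  | ke : SqLRel q w (ι ℂ SqLGen.k * ι ℂ SqLGen.e) ((q ^ 2) • (ι ℂ SqLGen.e * ι ℂ SqLGen.k))
  | kf : SqLRel q w (ι ℂ SqLGen.k * ι ℂ SqLGen.f) (((q ^ 2)⁻¹) • (ι ℂ SqLGen.f * ι ℂ SqLGen.k))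
  | ef : SqLRel q w (ι ℂ SqLGen.e * ι ℂ SqLGen.f - ι ℂ SqLGen.f * ι ℂ SqLGen.e)
      ((q - q⁻¹)⁻¹ • (ι ℂ SqLGen.k - ι ℂ SqLGen.k'))
  | kx : SqLRel q w (ι ℂ SqLGen.k * ι ℂ SqLGen.x) (q • (ι ℂ SqLGen.x * ι ℂ SqLGen.k))
  | ky : SqLRel q w (ι ℂ SqLGen.k * ι ℂ SqLGen.y) (q⁻¹ • (ι ℂ SqLGen.y * ι ℂ SqLGen.k))
  | yx : SqLRel q w (q • (ι ℂ SqLGen.y * ι ℂ SqLGen.x) - ι ℂ SqLGen.x * ι ℂ SqLGen.y)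
      (ι ℂ SqLGen.c)
  | ex : SqLRel q w (ι ℂ SqLGen.e * ι ℂ SqLGen.x) (q • (ι ℂ SqLGen.x * ι ℂ SqLGen.e))
  | ey : SqLRel q w (ι ℂ SqLGen.e * ι ℂ SqLGen.y)
      (ι ℂ SqLGen.x + q⁻¹ • (ι ℂ SqLGen.y * ι ℂ SqLGen.e))
  | central (g : SqLGen) : SqLRel q w (ι ℂ SqLGen.c * ι ℂ g) (ι ℂ g * ι ℂ SqLGen.c)
  | fx : SqLRel q w (ι ℂ SqLGen.f * ι ℂ SqLGen.x)
      (ι ℂ SqLGen.y * ι ℂ SqLGen.k' + ι ℂ SqLGen.x * ι ℂ SqLGen.f)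
  | fy : SqLRel q w (ι ℂ SqLGen.f * ι ℂ SqLGen.y) (ι ℂ SqLGen.y * ι ℂ SqLGen.f)

/-- The localization `S_q^{(w)}` at the powers of the generator `w`. -/
abbrev SqL (q : ℂ) (w : SqLGen) := RingQuot (SqLRel q w)

/-- The canonical generators of `S_q^{(w)}`. -/
noncomputable def sqLGen (q : ℂ) (w : SqLGen) (g : SqLGen) : SqL q w :=
  RingQuot.mkAlgHom ℂ (SqLRel q w) (FreeAlgebra.ι ℂ g)

/-- `θ` is the twisting automorphism `Θ_b^{(F)}` of `S_q^{(F)}`: it fixes `F^{±1}`, `Y`,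
`C` and acts on `X`, `K^{±1}`, `E` by the prescribed formulas (here `u = F⁻¹`). -/
noncomputable def IsThetaF (q b : ℂ) (θ : SqL q SqLGen.f ≃ₐ[ℂ] SqL q SqLGen.f) : Prop :=
  θ (sqLGen q SqLGen.f SqLGen.f) = sqLGen q SqLGen.f SqLGen.f ∧
  θ (sqLGen q SqLGen.f SqLGen.u) = sqLGen q SqLGen.f SqLGen.u ∧
  θ (sqLGen q SqLGen.f SqLGen.y) = sqLGen q SqLGen.f SqLGen.y ∧
  θ (sqLGen q SqLGen.f SqLGen.c) = sqLGen q SqLGen.f SqLGen.c ∧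
  θ (sqLGen q SqLGen.f SqLGen.x)
    = sqLGen q SqLGen.f SqLGen.x
      - ((b - 1) / (q ^ 2 - 1)) •
          (sqLGen q SqLGen.f SqLGen.u * sqLGen q SqLGen.f SqLGen.y *
            sqLGen q SqLGen.f SqLGen.k') ∧
  θ (sqLGen q SqLGen.f SqLGen.k) = b⁻¹ • sqLGen q SqLGen.f SqLGen.k ∧
  θ (sqLGen q SqLGen.f SqLGen.k') = b • sqLGen q SqLGen.f SqLGen.k' ∧
  θ (sqLGen q SqLGen.f SqLGen.e)
    = sqLGen q SqLGen.f SqLGen.e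
      + ((1 - b⁻¹) / ((q ^ 2 - 1) * (q - q⁻¹))) •
          (sqLGen q SqLGen.f SqLGen.k * sqLGen q SqLGen.f SqLGen.u)
      - ((1 - b) / (((q ^ 2)⁻¹ - 1) * (q - q⁻¹))) •
          (sqLGen q SqLGen.f SqLGen.k' * sqLGen q SqLGen.f SqLGen.u)

/-- `θ` is the twisting automorphism `Θ_b^{(Y)}` of `S_q^{(Y)}`: it fixes `Y^{±1}`, `F`,
`C` and acts on `X`, `K^{±1}`, `E` by the prescribed formulas (here `u = Y⁻¹`). -/
noncomputable def IsThetaY (q b : ℂ) (θ : SqL q SqLGen.y ≃ₐ[ℂ] SqL q SqLGen.y) : Prop :=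
  θ (sqLGen q SqLGen.y SqLGen.y) = sqLGen q SqLGen.y SqLGen.y ∧
  θ (sqLGen q SqLGen.y SqLGen.u) = sqLGen q SqLGen.y SqLGen.u ∧
  θ (sqLGen q SqLGen.y SqLGen.f) = sqLGen q SqLGen.y SqLGen.f ∧
  θ (sqLGen q SqLGen.y SqLGen.c) = sqLGen q SqLGen.y SqLGen.c ∧
  θ (sqLGen q SqLGen.y SqLGen.x)
    = b • sqLGen q SqLGen.y SqLGen.x
      - ((b - 1) / (q - 1)) •
          (sqLGen q SqLGen.y SqLGen.c * sqLGen q SqLGen.y SqLGen.u) ∧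
  θ (sqLGen q SqLGen.y SqLGen.k) = b⁻¹ • sqLGen q SqLGen.y SqLGen.k ∧
  θ (sqLGen q SqLGen.y SqLGen.k') = b • sqLGen q SqLGen.y SqLGen.k' ∧
  θ (sqLGen q SqLGen.y SqLGen.e)
    = b⁻¹ • sqLGen q SqLGen.y SqLGen.e
      + ((b - b⁻¹) / (q - q⁻¹)) •
          (sqLGen q SqLGen.y SqLGen.u * sqLGen q SqLGen.y SqLGen.x)
      - ((b + q * b⁻¹ - q - 1) / ((q - q⁻¹) * (q - 1))) •
          (sqLGen q SqLGen.y SqLGen.c * sqLGen q SqLGen.y SqLGen.u ^ 2)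

/-- Algebra homomorphisms out of `S_q^{(w)}` that agree on the generators are equal. -/
theorem SqL.algHom_ext {q : ℂ} {w : SqLGen} {A : Type*} [Semiring A] [Algebra ℂ A]
    {f g : SqL q w →ₐ[ℂ] A} (h : ∀ i, f (sqLGen q w i) = g (sqLGen q w i)) : f = g :=
  RingQuot.ringQuot_ext' ℂ f g (FreeAlgebra.hom_ext (funext h))

/-- The generator `c` commutes with every generator. -/
theorem sqLGen_c_mul (q : ℂ) (w g : SqLGen) :
    sqLGen q w SqLGen.c * sqLGen q w g = sqLGen q w g * sqLGen q w SqLGen.c := by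
  simpa only [sqLGen, map_mul] using RingQuot.mkAlgHom_rel ℂ (SqLRel.central (q := q) (w := w) g)

/-- The automorphisms `Θ_b^{(F)}` are multiplicative in `b`. -/
theorem IsThetaF.comp_apply {q x y : ℂ} (hx : x ≠ 0) (hy : y ≠ 0)
    {θx θy θxy : SqL q SqLGen.f ≃ₐ[ℂ] SqL q SqLGen.f}
    (h₁ : IsThetaF q x θx) (h₂ : IsThetaF q y θy) (h₃ : IsThetaF q (x * y) θxy)
    (a : SqL q SqLGen.f) : θx (θy a) = θxy a := by
  obtain ⟨f₁, u₁, y₁, c₁, x₁, k₁, l₁, e₁⟩ := h₁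
  obtain ⟨f₂, u₂, y₂, c₂, x₂, k₂, l₂, e₂⟩ := h₂
  obtain ⟨f₃, u₃, y₃, c₃, x₃, k₃, l₃, e₃⟩ := h₃
  suffices h : (θx : SqL q SqLGen.f →ₐ[ℂ] SqL q SqLGen.f).comp
      (θy : SqL q SqLGen.f →ₐ[ℂ] SqL q SqLGen.f) = θxy from
    DFunLike.congr_fun h a
  refine SqL.algHom_ext fun i => ?_
  change θx (θy _) = θxy _
  cases i with
  | c => rw [c₂, c₁, c₃]
  | f => rw [f₂, f₁, f₃]
  | y => rw [y₂, y₁, y₃]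
  | u => rw [u₂, u₁, u₃]
  | k => rw [k₂, k₃, map_smul, k₁, smul_smul, mul_inv, mul_comm]
  | k' => rw [l₂, l₃, map_smul, l₁, smul_smul, mul_comm]
  | x =>
    rw [x₂, x₃, map_sub, map_smul, map_mul, map_mul, x₁, u₁, y₁, l₁, mul_smul_comm]
    module
  | e =>
    rw [e₂, e₃]
    simp only [map_add, map_sub, map_smul, map_mul, e₁, u₁, k₁, l₁, smul_mul_assoc]
    generalize (q ^ 2 - 1) * (q - q⁻¹) = d
    generalize ((q ^ 2)⁻¹ - 1) * (q - q⁻¹) = d'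
    match_scalars <;> field_simp <;> ring

/-- The automorphisms `Θ_b^{(Y)}` are multiplicative in `b`. -/
theorem IsThetaY.comp_apply {q x y : ℂ} (hx : x ≠ 0) (hy : y ≠ 0)
    {θx θy θxy : SqL q SqLGen.y ≃ₐ[ℂ] SqL q SqLGen.y}
    (h₁ : IsThetaY q x θx) (h₂ : IsThetaY q y θy) (h₃ : IsThetaY q (x * y) θxy)
    (a : SqL q SqLGen.y) : θx (θy a) = θxy a := by
  obtain ⟨y₁, u₁, f₁, c₁, x₁, k₁, l₁, e₁⟩ := h₁
  obtain ⟨y₂, u₂, f₂, c₂, x₂, k₂, l₂, e₂⟩ := h₂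
  obtain ⟨y₃, u₃, f₃, c₃, x₃, k₃, l₃, e₃⟩ := h₃
  suffices h : (θx : SqL q SqLGen.y →ₐ[ℂ] SqL q SqLGen.y).comp
      (θy : SqL q SqLGen.y →ₐ[ℂ] SqL q SqLGen.y) = θxy from
    DFunLike.congr_fun h a
  refine SqL.algHom_ext fun i => ?_
  change θx (θy _) = θxy _
  cases i with
  | c => rw [c₂, c₁, c₃]
  | f => rw [f₂, f₁, f₃]
  | y => rw [y₂, y₁, y₃]
  | u => rw [u₂, u₁, u₃]
  | k => rw [k₂, k₃, map_smul, k₁, smul_smul, mul_inv, mul_comm]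
  | k' => rw [l₂, l₃, map_smul, l₁, smul_smul, mul_comm]
  | x =>
    rw [x₂, x₃, map_sub, map_smul, map_smul, map_mul, x₁, u₁, c₁]
    module
  | e =>
    have hux : θx (sqLGen q SqLGen.y SqLGen.u * sqLGen q SqLGen.y SqLGen.x) =
        x • (sqLGen q SqLGen.y SqLGen.u * sqLGen q SqLGen.y SqLGen.x) -
          ((x - 1) / (q - 1)) •
            (sqLGen q SqLGen.y SqLGen.c * sqLGen q SqLGen.y SqLGen.u ^ 2) := by
      rw [map_mul, u₁, x₁, mul_sub, mul_smul_comm, mul_smul_comm, ← mul_assoc,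
        ← sqLGen_c_mul, mul_assoc, ← sq]
    rw [e₂, e₃, map_sub, map_add, map_smul, map_smul, map_smul, hux, e₁, map_mul, map_pow,
      u₁, c₁]
    generalize q - q⁻¹ = d
    generalize q - 1 = d'
    match_scalars <;> field_simp <;> ring

/-- For `u ∈ {F, Y}` and `x, y ∈ ℂ*`, the twisting automorphisms satisfy
`Θ_x^{(u)} ∘ Θ_y^{(u)} = Θ_{xy}^{(u)}`. -/
theorem stmt18 (q : ℂ) (hq : q ≠ 0) (hroot : ∀ n : ℕ, 0 < n → q ^ n ≠ 1)
    (x y : ℂ) (hx : x ≠ 0) (hy : y ≠ 0) :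
    (∀ (θx θy θxy : SqL q SqLGen.f ≃ₐ[ℂ] SqL q SqLGen.f),
      IsThetaF q x θx → IsThetaF q y θy → IsThetaF q (x * y) θxy →
      ∀ a : SqL q SqLGen.f, θx (θy a) = θxy a) ∧
    (∀ (θx θy θxy : SqL q SqLGen.y ≃ₐ[ℂ] SqL q SqLGen.y),
      IsThetaY q x θx → IsThetaY q y θy → IsThetaY q (x * y) θxy →
      ∀ a : SqL q SqLGen.y, θx (θy a) = θxy a) := by
  exact ⟨fun _ _ _ h₁ h₂ h₃ => h₁.comp_apply hx hy h₂ h₃,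
    fun _ _ _ h₁ h₂ h₃ => h₁.comp_apply hx hy h₂ h₃⟩
end
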